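/- For every b ∈ (0, 1) there exists a constant C > 0 such that for all integers N ≥ 1 and all integers M with 1 ≤ M ≤ 4N, one has N^{−2} Σ_{i=0}^{M−1} Σ_{j=0}^{M−1} log(1 + N/(|i−j|+1)) ≤ C (M/N)^{1+b}. -/

import Mathlib

open scoped BigOperators

lemma aux_step (b : ℝ) (hb0 : 0 < b) (hb1 : b < 1) (n : ℕ) :
    (n : ℝ) ^ b / b + ((n : ℝ) + 1) ^ (b - 1) ≤ ((n : ℝ) + 1) ^ b / b := by
  have hn : (0 : ℝ) < (n : ℝ) + 1 := by positivity
  have h1 : (1 + -(1 / ((n : ℝ) + 1))) ^ b ≤ 1 + b * (-(1 / ((n : ℝ) + 1))) := by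
    apply rpow_one_add_le_one_add_mul_self _ hb0.le hb1.le
    have : 1 / ((n : ℝ) + 1) ≤ 1 := by
      rw [div_le_one hn]; linarith [(Nat.cast_nonneg n : (0 : ℝ) ≤ n)]
    linarith
  have h2 : (1 + -(1 / ((n : ℝ) + 1))) = (n : ℝ) / ((n : ℝ) + 1) := by field_simp; ring
  rw [h2, Real.div_rpow (Nat.cast_nonneg n) hn.le, div_le_iff₀ (by positivity)] at h1
  rw [Real.rpow_sub_one hn.ne', div_add' _ _ _ hb0.ne', div_le_div_iff_of_pos_right hb0]
  have : (1 + b * (-(1 / ((n : ℝ) + 1)))) * ((n : ℝ) + 1) ^ b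
      = ((n : ℝ) + 1) ^ b - ((n : ℝ) + 1) ^ b / ((n : ℝ) + 1) * b := by
    field_simp; ring
  linarith

lemma aux_sum (b : ℝ) (hb0 : 0 < b) (hb1 : b < 1) (M : ℕ) :
    ∑ k ∈ Finset.range M, ((k : ℝ) + 1) ^ (b - 1) ≤ (M : ℝ) ^ b / b := by
  induction M with
  | zero => simp [Real.zero_rpow hb0.ne']
  | succ n ih =>
    rw [Finset.sum_range_succ]
    push_cast
    linarith [aux_step b hb0 hb1 n]

lemma aux_row (b : ℝ) (M : ℕ) :
    ∑ j ∈ Finset.range (M + 1), (|(M : ℝ) - (j : ℝ)| + 1) ^ (b - 1)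
      = ∑ k ∈ Finset.range (M + 1), ((k : ℝ) + 1) ^ (b - 1) := by
  rw [← Finset.sum_range_reflect (fun k : ℕ => ((k : ℝ) + 1) ^ (b - 1))]
  apply Finset.sum_congr rfl
  intro j hj
  have hj' : j ≤ M := by have := Finset.mem_range.1 hj; omega
  have h : (j : ℝ) ≤ M := by exact_mod_cast hj'
  rw [abs_of_nonneg (by linarith)]
  simp only [Nat.add_sub_cancel]
  rw [Nat.cast_sub hj']

lemma aux_double (b : ℝ) (hb0 : 0 < b) (hb1 : b < 1) (M : ℕ) :
    ∑ i ∈ Finset.range M, ∑ j ∈ Finset.range M, (|(i : ℝ) - (j : ℝ)| + 1) ^ (b - 1)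
      ≤ 2 * M * ((M : ℝ) ^ b / b) := by
  induction M with
  | zero => simp
  | succ n ih =>
    have hr := aux_row b n
    have hs := aux_sum b hb0 hb1 (n + 1)
    rw [← hr] at hs
    rw [Finset.sum_range_succ]
    have h1 : ∑ i ∈ Finset.range n, ∑ j ∈ Finset.range (n + 1),
        (|(i : ℝ) - (j : ℝ)| + 1) ^ (b - 1)
        = ∑ i ∈ Finset.range n, ∑ j ∈ Finset.range n, (|(i : ℝ) - (j : ℝ)| + 1) ^ (b - 1)
          + ∑ i ∈ Finset.range n, (|(n : ℝ) - (i : ℝ)| + 1) ^ (b - 1) := by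
      rw [← Finset.sum_add_distrib]
      apply Finset.sum_congr rfl
      intro i _
      rw [Finset.sum_range_succ, abs_sub_comm (i : ℝ) (n : ℝ)]
    have h2 : ∑ i ∈ Finset.range n, (|(n : ℝ) - (i : ℝ)| + 1) ^ (b - 1)
        ≤ ∑ i ∈ Finset.range (n + 1), (|(n : ℝ) - (i : ℝ)| + 1) ^ (b - 1) := by
      rw [Finset.sum_range_succ]
      have : 0 ≤ (|(n : ℝ) - (n : ℝ)| + 1) ^ (b - 1) := by positivity
      linarith
    have h3 : 2 * (n : ℝ) * ((n : ℝ) ^ b / b) ≤ 2 * (n : ℝ) * (((n + 1 : ℕ) : ℝ) ^ b / b) := by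
      gcongr
      omega
    have h4 : 2 * ((n + 1 : ℕ) : ℝ) * (((n + 1 : ℕ) : ℝ) ^ b / b)
      = 2 * (n : ℝ) * (((n + 1 : ℕ) : ℝ) ^ b / b) + 2 * (((n + 1 : ℕ) : ℝ) ^ b / b) := by
      push_cast; ring
    linarith

lemma aux_log (a : ℝ) (ha0 : 0 < a) (ha1 : a < 1) (x : ℝ) (hx : 0 < x) :
    Real.log (1 + x) ≤ x ^ a / a := by
  rw [le_div_iff₀ ha0, mul_comm, ← Real.log_rpow (by linarith)]
  have h := Real.rpow_add_le_add_rpow (zero_le_one) hx.le ha0.le ha1.le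
  rw [Real.one_rpow] at h
  have hp : 0 < (1 + x) ^ a := by positivity
  have := Real.log_le_sub_one_of_pos hp
  linarith

/-- For every `b ∈ (0,1)` there is `C > 0` such that for all integers
`N ≥ 1` and `1 ≤ M ≤ 4N`,
`N^{-2} Σ_{i=0}^{M-1} Σ_{j=0}^{M-1} log(1 + N/(|i-j|+1)) ≤ C (M/N)^{1+b}`. -/
theorem statement13 (b : ℝ) (hb : b ∈ Set.Ioo (0 : ℝ) 1) :
    ∃ C : ℝ, 0 < C ∧ ∀ N M : ℕ, 1 ≤ N → 1 ≤ M → M ≤ 4 * N →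
      ((N : ℝ))⁻¹ ^ 2 *
          ∑ i ∈ Finset.range M, ∑ j ∈ Finset.range M,
            Real.log (1 + (N : ℝ) / (|(i : ℝ) - (j : ℝ)| + 1))
        ≤ C * ((M : ℝ) / N) ^ (1 + b) := by
  obtain ⟨hb0, hb1⟩ := hb
  have ha : 0 < 1 - b := by linarith
  refine ⟨2 / ((1 - b) * b), by positivity, ?_⟩
  intro N M hN hM _
  have hN' : (0 : ℝ) < N := by exact_mod_cast hN
  have hM' : (0 : ℝ) < M := by exact_mod_cast hM
  have h1 : ∑ i ∈ Finset.range M, ∑ j ∈ Finset.range M,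
            Real.log (1 + (N : ℝ) / (|(i : ℝ) - (j : ℝ)| + 1))
      ≤ (N : ℝ) ^ (1 - b) / (1 - b) * ∑ i ∈ Finset.range M, ∑ j ∈ Finset.range M,
        (|(i : ℝ) - (j : ℝ)| + 1) ^ (b - 1) := by
    simp only [Finset.mul_sum]
    refine Finset.sum_le_sum fun i _ => Finset.sum_le_sum fun j _ => ?_
    have hp : 0 < |(i : ℝ) - (j : ℝ)| + 1 := by positivity
    refine (aux_log (1 - b) ha (by linarith) _ (by positivity)).trans (le_of_eq ?_)
    rw [Real.div_rpow hN'.le hp.le, show b - 1 = -(1 - b) by ring, Real.rpow_neg hp.le]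
    ring
  have h2 := h1.trans (mul_le_mul_of_nonneg_left (aux_double b hb0 hb1 M) (by positivity))
  refine (mul_le_mul_of_nonneg_left h2 (by positivity)).trans (le_of_eq ?_)
  rw [Real.div_rpow hM'.le hN'.le, Real.rpow_add hM', Real.rpow_add hN', Real.rpow_sub hN',
    Real.rpow_one, Real.rpow_one]
  field_simp
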